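/- Let Φ : 𝓑 → 𝓑 be a lower density operator on the Borel subsets of ℝ × ℝ with respect to the σ-ideal of countable sets, and let x ∈ ℝ be such that the set T := {t ∈ ℝ : x ∈ π₂[Φ({t} × ℝ)]} is uncountable (π₂ is the projection onto the second coordinate). Then for P := ℝ × {x}, the set P \ Φ(P) is uncountable; in particular no such Φ can exist together with such an x, contradicting property (3). -/

import Mathlib

open Set

/-- `Φ` is a lower density operator on the Borel σ-algebra of `X` with respect to the
σ-ideal of countable sets: it maps Borel sets to Borel sets and satisfies (1)–(4). -/
def IsCountableLowerDensity {X : Type*} [MeasurableSpace X] (Φ : Set X → Set X) : Prop :=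
  (∀ A : Set X, MeasurableSet A → MeasurableSet (Φ A)) ∧
  (Φ Set.univ = Set.univ ∧ Φ ∅ = ∅) ∧
  (∀ A B : Set X, MeasurableSet A → MeasurableSet B →
    (symmDiff A B).Countable → Φ A = Φ B) ∧
  (∀ A : Set X, MeasurableSet A → (symmDiff A (Φ A)).Countable) ∧
  (∀ A B : Set X, MeasurableSet A → MeasurableSet B → Φ (A ∩ B) = Φ A ∩ Φ B)

/-- A lower density operator sends Borel sets with countable intersection to disjoint sets. -/
theorem IsCountableLowerDensity.disjoint_of_countable_inter {X : Type*} [MeasurableSpace X]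
    {Φ : Set X → Set X} (hΦ : IsCountableLowerDensity Φ) {A B : Set X}
    (hA : MeasurableSet A) (hB : MeasurableSet B) (hAB : (A ∩ B).Countable) :
    Disjoint (Φ A) (Φ B) := by
  obtain ⟨-, ⟨-, hempty⟩, hcongr, -, hinter⟩ := hΦ
  rw [Set.disjoint_iff_inter_eq_empty, ← hinter A B hA hB, ← hempty]
  refine hcongr _ _ (hA.inter hB) MeasurableSet.empty ?_
  rwa [← Set.bot_eq_empty, symmDiff_bot]

theorem horizontal_line_escapes_lower_density
    (Φ : Set (ℝ × ℝ) → Set (ℝ × ℝ)) (hΦ : IsCountableLowerDensity Φ)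
    (x : ℝ)
    (hx : ¬ Set.Countable
      {t : ℝ | x ∈ Prod.snd '' Φ (({t} : Set ℝ) ×ˢ (Set.univ : Set ℝ))}) :
    ¬ Set.Countable
      (((Set.univ : Set ℝ) ×ˢ ({x} : Set ℝ)) \ Φ ((Set.univ : Set ℝ) ×ˢ ({x} : Set ℝ))) := by
  intro hcount
  apply hx
  have hvert (t : ℝ) : MeasurableSet (({t} : Set ℝ) ×ˢ (Set.univ : Set ℝ)) :=
    (measurableSet_singleton t).prod MeasurableSet.univ
  have hhor : MeasurableSet ((Set.univ : Set ℝ) ×ˢ ({x} : Set ℝ)) :=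
    MeasurableSet.univ.prod (measurableSet_singleton x)
  have hex (t : ℝ) : ∃ p : ℝ × ℝ, x ∈ Prod.snd '' Φ (({t} : Set ℝ) ×ˢ (Set.univ : Set ℝ)) →
      p ∈ Φ (({t} : Set ℝ) ×ˢ (Set.univ : Set ℝ)) ∧ p.2 = x := by
    by_cases h : x ∈ Prod.snd '' Φ (({t} : Set ℝ) ×ˢ (Set.univ : Set ℝ))
    · obtain ⟨p, hp⟩ := h
      exact ⟨p, fun _ => hp⟩
    · exact ⟨0, fun h' => absurd h' h⟩
  choose p hp using hex
  refine Set.MapsTo.countable_of_injOn (f := p) ?_ ?_ hcount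
  · intro t ht
    obtain ⟨hmem, hsnd⟩ := hp t ht
    refine ⟨⟨Set.mem_univ _, hsnd⟩, ?_⟩
    refine Set.disjoint_left.1 (hΦ.disjoint_of_countable_inter (hvert t) hhor ?_) hmem
    rw [Set.prod_inter_prod, Set.inter_univ, Set.univ_inter, Set.singleton_prod_singleton]
    exact Set.countable_singleton _
  · intro t ht s hs hts
    by_contra hne
    refine Set.disjoint_left.1 (hΦ.disjoint_of_countable_inter (hvert t) (hvert s) ?_)
      (hp t ht).1 (hts ▸ (hp s hs).1)
    rw [Set.prod_inter_prod, Set.singleton_inter_eq_empty.2 (by simpa using hne),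
      Set.empty_prod]
    exact Set.countable_empty
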